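/- (Main Lemma (iv)) Let e=(u,v) be a non-leaf-edge of depth d−1 in a rooted tree instance, assume all edges of depth at least d satisfy conditions (a) and (b), and let ⟨ã,b̃⟩ = Ψ(e1)⊗Ψ(e2) for the two child-edges e1, e2 of e. If I(e) admits a blocking flow f with f(e) < c(e), then f(e) ∈ ⟨ã,b̃⟩. -/

import Mathlib

open Classical

/-- `⟨a,b⟩`: the set `{a, a+2, …, b}` of consecutive odd or even integers. -/
def Iv (a b : ℕ) : Set ℕ := {x | a ≤ x ∧ x ≤ b ∧ x % 2 = a % 2}

/-- `A ⊗ B = {a + b − 2i : a ∈ A, b ∈ B, 0 ≤ i ≤ min(a,b)}`. -/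
def otimes (A B : Set ℕ) : Set ℕ :=
  {x | ∃ a ∈ A, ∃ b ∈ B, ∃ i, i ≤ min a b ∧ x = a + b - 2 * i}

/-- A tree instance `(G,T,c)` rooted at a terminal `r`: a tree on vertex set `V`,
encoded by the parent function `par` (with `par root = root`) together with a depth
function certifying acyclicity.  Each non-root vertex `v` is identified with the edge
`(par v, v)`; `c v` is the (positive integer) capacity of that edge.  The terminals are
the leaves; the root has exactly one child and every internal vertex has exactly
two children (total degree 3). -/
structure RTI (V : Type*) where
  root : V
  par : V → V
  dep : V → ℕ
  c : V → ℕ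
  par_root : par root = root
  dep_root : dep root = 0
  dep_par : ∀ v, v ≠ root → dep v = dep (par v) + 1
  cap_pos : ∀ v, v ≠ root → 1 ≤ c v
  root_degree : {w : V | par w = root ∧ w ≠ root}.ncard = 1
  internal_degree : ∀ v, v ≠ root → {w : V | par w = v ∧ w ≠ root}.Nonempty →
    {w : V | par w = v ∧ w ≠ root}.ncard = 2

namespace RTI

variable {V : Type*} (R : RTI V)

/-- `R.below u v`: `v` lies in the subtree rooted at `u` (i.e. `u` is an ancestor of
`v`, allowing `u = v`). -/
def below (u v : V) : Prop :=
  Relation.ReflTransGen (fun a b => R.par b = a ∧ b ≠ R.root) u v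

/-- `v` is a leaf of the tree other than the root. -/
def leaf (v : V) : Prop := v ≠ R.root ∧ ∀ w, w ≠ R.root → R.par w ≠ v

/-- The children of `v` (as lower endpoints of child-edges). -/
def children (v : V) : Set V := {w | R.par w = v ∧ w ≠ R.root}

/-- For an edge `e = (par v, v)`, the vertex set `V_e` of the instance `I(e)`. -/
def Ve (v : V) : Set V := insert (R.par v) {w | R.below v w}

/-- `T_e`: the terminals of `I(e)` other than `u = par v`. -/
def Te (v : V) : Set V := {w | R.below v w ∧ R.leaf w}

/-- The full terminal set `T_e ∪ {u}` of the instance `I(e)`. -/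
def S (v : V) : Set V := insert (R.par v) (R.Te v)

/-- The edge `(par x, x)` lies on the tree path between `t` and `t'`
(exactly one of `t, t'` is in the subtree below `x`). -/
def onPath (x t t' : V) : Prop :=
  (R.below x t ∧ ¬ R.below x t') ∨ (¬ R.below x t ∧ R.below x t')

/-- The vertex `x` lies on the tree path between `t` and `t'`. -/
def onPathV (x t t' : V) : Prop :=
  (R.below x t ∨ R.below x t') ∧ ∀ z, R.below z t → R.below z t' → R.below z x

/-- Unordered pairs of distinct terminals of the instance `I(e)` for `e = (par v, v)`. -/
def PathPairs (v : V) : Set (Sym2 V) :=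
  {p | ∃ t t', t ∈ R.S v ∧ t' ∈ R.S v ∧ t ≠ t' ∧ p = s(t, t')}

/-- `g` is a decomposition of `f` in the instance `I(e)`, `e = (par v, v)`:
`g` is supported on pairs of distinct terminals and, on every edge of `I(e)`,
`f` is the sum of `g` over the (unique) terminal-pair paths through that edge. -/
def IsDecomp (v : V) (f : V → ℕ) (g : Sym2 V → ℕ) : Prop :=
  (∀ p, g p ≠ 0 → p ∈ R.PathPairs v) ∧
  ∀ w, R.below v w →
    f w = ∑ᶠ p ∈ {p : Sym2 V | ∃ t t', p = s(t, t') ∧ R.onPath w t t'}, g p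

/-- `f` is an (integral) flow in the instance `I(e)`, `e = (par v, v)`. -/
def IsFlow (v : V) (f : V → ℕ) : Prop := ∃ g, R.IsDecomp v f g

/-- `f` is feasible in `I(e)`. -/
def Feasible (v : V) (f : V → ℕ) : Prop := ∀ w, R.below v w → f w ≤ R.c w

/-- `V_f(s)`: the set of vertices `w` of `I(e)` reachable from `s` by travelling
upward along edges with `c − f ≥ 1` to a common ancestor and then downward along
edges with `c − f ≥ 2`. -/
def Vf (v : V) (f : V → ℕ) (s : V) : Set V :=
  {w | w ∈ R.Ve v ∧ ∃ z ∈ R.Ve v, R.below z s ∧ R.below z w ∧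
    (∀ x, R.below z x → R.below x s → x ≠ z → f x + 1 ≤ R.c x) ∧
    (∀ x, R.below z x → R.below x w → x ≠ z → f x + 2 ≤ R.c x)}

/-- `W` induces a connected subgraph of the tree (it is closed under tree paths). -/
def ConnSet (W : Set V) : Prop :=
  ∀ w₁ ∈ W, ∀ w₂ ∈ W, ∀ x, R.onPathV x w₁ w₂ → x ∈ W

/-- `E(X)` inside the instance `I(e)`, `e = (par v, v)`: the edges `(par x, x)` of
`I(e)` with exactly one endpoint in `X`. -/
def cutE (v : V) (X : Set V) : Set V :=
  {x | R.below v x ∧ ¬ (x ∈ X ↔ R.par x ∈ X)}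

/-- `h(X) = Σ_{e' ∈ E(X)} h(e')` inside the instance `I(e)`, `e = (par v, v)`. -/
noncomputable def hval (v : V) (X : Set V) (h : V → ℕ) : ℕ := ∑ᶠ x ∈ R.cutE v X, h x

/-- `W` is a connected component of the subgraph of `I(e)` induced by `A`. -/
def IsComp (v : V) (A W : Set V) : Prop :=
  W.Nonempty ∧ W ⊆ A ∧ R.ConnSet W ∧
  (∀ x, R.below v x → x ∈ W → R.par x ∈ A → R.par x ∈ W) ∧
  (∀ x, R.below v x → R.par x ∈ W → x ∈ A → x ∈ W)

/-- `odd(X)` (relative to the union `U` of the removed terminal sets): the components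
`W` of `G_e − U` with `c(W)` odd whose parent-edge is a child-edge of `X`. -/
def oddOf (v : V) (U X : Set V) : Set (Set V) :=
  {W | R.IsComp v (R.Ve v \ U) W ∧ Odd (R.hval v W R.c) ∧
    ∃ y ∈ W, R.par y ∉ W ∧ R.par y ∈ X}

/-- The union of the sets `V_f(t)`, `t ∈ T_e`. -/
def UT (v : V) (f : V → ℕ) : Set V := ⋃ t ∈ R.Te v, R.Vf v f t

/-- The union of the sets `V_f(t)`, `t ∈ T_e ∪ {u}`. -/
def USall (v : V) (f : V → ℕ) : Set V := ⋃ t ∈ R.S v, R.Vf v f t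

/-- `f` is a blocking flow in `I(e)`, `e = (par v, v)`: a feasible flow such that
`{V_f(t) : t ∈ T_e}` is a cut-system of `T_e` (pairwise disjoint `t`-sets avoiding the
terminal `u = par v`) each member of which is blocked by `f`, i.e.
`f(e_t) = f(V_f(t)) = c(V_f(t)) − |odd(V_f(t))|`. -/
def IsBlocking (v : V) (f : V → ℕ) : Prop :=
  R.IsFlow v f ∧ R.Feasible v f ∧
  (∀ t ∈ R.Te v, R.par v ∉ R.Vf v f t) ∧
  (∀ t ∈ R.Te v, ∀ t' ∈ R.Te v, t ≠ t' → R.Vf v f t ∩ R.Vf v f t' = ∅) ∧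
  (∀ t ∈ R.Te v, f t = R.hval v (R.Vf v f t) f ∧
    R.hval v (R.Vf v f t) f + (R.oddOf v (R.UT v f) (R.Vf v f t)).ncard
      = R.hval v (R.Vf v f t) R.c)

/-- `Ψ(e)`: the set of values `f(e)` of blocking flows `f` of `I(e)`, `e = (par v, v)`. -/
def Psi (v : V) : Set ℕ := {x | ∃ f, R.IsBlocking v f ∧ f v = x}

/-- `a(e)`: the least element of `Ψ(e)`. -/
noncomputable def aE (v : V) : ℕ := sInf (R.Psi v)

/-- `b(e)`: the greatest element of `Ψ(e)`. -/
noncomputable def bE (v : V) : ℕ := sSup (R.Psi v)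

/-- The edge `(par x, x)` is dominating: `b(e') + 2 ≤ a(e)` for its sibling edge `e'`. -/
def Dominating (x : V) : Prop :=
  x ≠ R.root ∧ ∃ y, y ≠ R.root ∧ y ≠ x ∧ R.par y = R.par x ∧ R.bE y + 2 ≤ R.aE x

/-- The path from `v` down to `t` consists of dominating edges. -/
def DomPath (v t : V) : Prop :=
  R.below v t ∧ ∀ x, R.below v x → R.below x t → x ≠ v → R.Dominating x

/-- Condition (a) for the edge `e = (par v, v)`. -/
def CondA (v : V) : Prop :=
  (∃ a b, R.Psi v = Iv a b) ∧
  (R.leaf v → R.Psi v = {R.c v}) ∧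
  (∀ w₁ w₂, w₁ ≠ w₂ → R.children v = {w₁, w₂} →
    R.Psi v = (otimes (R.Psi w₁) (R.Psi w₂) ∩ Set.Iic (R.c v)) ∪ {R.c v})

/-- Condition (b) for the edge `e = (u,v)`: if `e` has a dominating child-edge
`e' = (v,w)`, then there is a terminal `t ∈ T_{e'}` with `g(u,t) ≥ a(e)` for every
decomposition `g` of every blocking flow of `I(e)`, and `P_{v,t}` a dominating path. -/
def CondB (v : V) : Prop :=
  ∀ w ∈ R.children v, R.Dominating w →
    ∃ t ∈ R.Te w, R.DomPath v t ∧
      ∀ f g, R.IsBlocking v f → R.IsDecomp v f g → R.aE v ≤ g s(R.par v, t)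

/-- `γ(𝒳)` for the cut-system `𝒳 = {V_f(t) : t ∈ T_e ∪ {u}}`. -/
noncomputable def gammaX (v : V) (f : V → ℕ) : ℕ :=
  ∑ᶠ t ∈ R.S v, R.hval v (R.Vf v f t) R.c

/-- `κ(𝒳)` for the cut-system `𝒳 = {V_f(t) : t ∈ T_e ∪ {u}}`: the number of
components of `G_e − ∪𝒳` of odd capacity. -/
noncomputable def kappaX (v : V) (f : V → ℕ) : ℕ :=
  {W : Set V | R.IsComp v (R.Ve v \ R.USall v f) W ∧ Odd (R.hval v W R.c)}.ncard

end RTI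

namespace RTI

variable {V : Type*} {R : RTI V}

theorem below_refl (a : V) : R.below a a := Relation.ReflTransGen.refl

theorem below.trans {a b d : V} (h : R.below a b) (h' : R.below b d) : R.below a d :=
  Relation.ReflTransGen.trans h h'

theorem below_par {x : V} (hx : x ≠ R.root) : R.below (R.par x) x :=
  Relation.ReflTransGen.single ⟨rfl, hx⟩

theorem below.eq_or_par {a b : V} (h : R.below a b) :
    a = b ∨ (b ≠ R.root ∧ R.below a (R.par b)) := by
  rcases Relation.ReflTransGen.cases_tail h with h | ⟨d, h, rfl, hb⟩
  · exact Or.inl h.symm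
  · exact Or.inr ⟨hb, h⟩

theorem below.ne_root {a b : V} (h : R.below a b) (ha : a ≠ R.root) : b ≠ R.root := by
  rcases h.eq_or_par with rfl | h
  · exact ha
  · exact h.1

theorem below.dep_le {a b : V} (h : R.below a b) : R.dep a ≤ R.dep b := by
  induction h with
  | refl => exact le_rfl
  | tail _ h ih =>
    obtain ⟨rfl, hb⟩ := h
    have := R.dep_par _ hb
    omega

theorem below.antisymm {a b : V} (h : R.below a b) (h' : R.below b a) : a = b := by
  rcases h.eq_or_par with h | ⟨hb, h⟩
  · exact h
  · have h1 := h.dep_le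
    have h2 := h'.dep_le
    have h3 := R.dep_par _ hb
    omega

theorem not_below_par {x : V} (hx : x ≠ R.root) : ¬ R.below x (R.par x) := fun h => by
  have h1 := h.dep_le
  have h2 := R.dep_par _ hx
  omega

theorem below.total {a b x : V} (h : R.below a x) (h' : R.below b x) :
    R.below a b ∨ R.below b a := by
  induction h with
  | refl => exact Or.inr h'
  | tail h hs ih =>
    obtain ⟨rfl, hx⟩ := hs
    rcases h'.eq_or_par with rfl | ⟨_, h'⟩
    · exact Or.inl (h.trans (below_par hx))
    · exact ih h'

/-- A vertex comparable with `w` is below `w` unless it is an ancestor of `par w`. -/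
theorem below.below_or_par {z w x : V} (h : R.below z x) (hw : R.below w x) :
    R.below w z ∨ R.below z (R.par w) := by
  rcases h.total hw with h | h
  · rcases h.eq_or_par with rfl | h
    · exact Or.inl (below_refl _)
    · exact Or.inr h.2
  · exact Or.inl h

theorem Ve_subset_Ve_par {w : V} (hw : w ≠ R.root) : R.Ve w ⊆ R.Ve (R.par w) := by
  rintro x (rfl | hx)
  · exact Or.inr (below_refl _)
  · exact Or.inr ((below_par hw).trans hx)

theorem Te_subset_Te_par {w : V} (hw : w ≠ R.root) : R.Te w ⊆ R.Te (R.par w) :=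
  fun _ h => ⟨(below_par hw).trans h.1, h.2⟩

theorem par_mem_Ve {w x : V} (hx : R.below w x) : R.par x ∈ R.Ve w := by
  rcases hx.eq_or_par with rfl | h
  · exact Or.inl rfl
  · exact Or.inr h.2

/-- An unsaturated top edge of a blocking flow has a lower endpoint outside all the sets
`V_f(t)`. -/
theorem IsBlocking.top_notMem {v t : V} {f : V → ℕ} (hf : R.IsBlocking v f)
    (hv : v ≠ R.root) (hlt : f v < R.c v) (ht : t ∈ R.Te v) : v ∉ R.Vf v f t := by
  rintro ⟨-, z, hz, hzt, hzv, h1, -⟩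
  refine hf.2.2.1 t ht ⟨Or.inl rfl, R.par v, Or.inl rfl, (below_par hv).trans ht.1,
    below_refl _, ?_, fun x hx hx' hne => absurd (hx'.antisymm hx) hne⟩
  intro x hx hxt hne
  rcases hxt.below_or_par ht.1 with hvx | hvx
  · by_cases hxv : x = v
    · exact hxv ▸ hlt
    · refine h1 x (hzv.trans hvx) hxt ?_
      rintro rfl
      exact hxv (hzv.antisymm hvx)
  · exact absurd (hvx.antisymm hx) hne

/-- Below an unsaturated top edge `(par v, v)` the apex of any path defining `V_f(t)` lies
strictly below `v`. -/
theorem IsBlocking.mem_Vf_apex {v t x : V} {f : V → ℕ} (hf : R.IsBlocking v f)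
    (hv : v ≠ R.root) (hlt : f v < R.c v) (ht : t ∈ R.Te v) (hx : x ∈ R.Vf v f t) :
    ∃ z, R.below v z ∧ z ≠ v ∧ R.below z t ∧ R.below z x ∧
      (∀ y, R.below z y → R.below y t → y ≠ z → f y + 1 ≤ R.c y) ∧
      (∀ y, R.below z y → R.below y x → y ≠ z → f y + 2 ≤ R.c y) := by
  obtain ⟨-, z, hz, hzt, hzx, h1, h2⟩ := hx
  have hmem : z ∈ R.Vf v f t := ⟨hz, z, hz, hzt, below_refl _, h1,
    fun y hy hy' hne => absurd (hy'.antisymm hy) hne⟩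
  rcases hz with rfl | hvz
  · exact absurd hmem (hf.2.2.1 t ht)
  · refine ⟨z, hvz, ?_, hzt, hzx, h1, h2⟩
    rintro rfl
    exact hf.top_notMem hv hlt ht hmem

theorem below_of_strict {w z x : V} (hz : R.below (R.par w) z) (hne : z ≠ R.par w)
    (hzx : R.below z x) (hwx : R.below w x) : R.below w z :=
  (hzx.below_or_par hwx).resolve_right fun h => hne (h.antisymm hz)

theorem IsBlocking.mem_Vf_below_iff {w t x : V} {f : V → ℕ} (hf : R.IsBlocking (R.par w) f)
    (hv : R.par w ≠ R.root) (hlt : f (R.par w) < R.c (R.par w))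
    (ht : t ∈ R.Te (R.par w)) (hx : x ∈ R.Vf (R.par w) f t) :
    R.below w x ↔ R.below w t := by
  obtain ⟨z, hvz, hne, hzt, hzx, -, -⟩ := hf.mem_Vf_apex hv hlt ht hx
  exact ⟨fun h => (below_of_strict hvz hne hzx h).trans hzt,
    fun h => (below_of_strict hvz hne hzt h).trans hzx⟩

theorem IsBlocking.Vf_child {w t : V} {f : V → ℕ} (hf : R.IsBlocking (R.par w) f)
    (hw : w ≠ R.root) (hv : R.par w ≠ R.root) (hlt : f (R.par w) < R.c (R.par w))
    (ht : t ∈ R.Te w) : R.Vf w f t = R.Vf (R.par w) f t := by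
  ext x
  constructor
  · rintro ⟨hx, z, hz, h⟩
    exact ⟨Ve_subset_Ve_par hw hx, z, Ve_subset_Ve_par hw hz, h⟩
  · intro hx
    obtain ⟨z, hvz, hne, hzt, hzx, h1, h2⟩ :=
      hf.mem_Vf_apex hv hlt (Te_subset_Te_par hw ht) hx
    have hwz := below_of_strict hvz hne hzt ht.1
    exact ⟨Or.inr (hwz.trans hzx), z, Or.inr hwz, hzt, hzx, h1, h2⟩

theorem IsBlocking.mem_UT_child_iff {w x : V} {f : V → ℕ} (hf : R.IsBlocking (R.par w) f)
    (hw : w ≠ R.root) (hv : R.par w ≠ R.root) (hlt : f (R.par w) < R.c (R.par w))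
    (hx : x ∈ R.Ve w) : x ∈ R.UT w f ↔ x ∈ R.UT (R.par w) f := by
  simp only [UT, Set.mem_iUnion, exists_prop]
  constructor
  · rintro ⟨t, ht, h⟩
    exact ⟨t, Te_subset_Te_par hw ht, hf.Vf_child hw hv hlt ht ▸ h⟩
  · rintro ⟨t, ht, h⟩
    rcases hx with rfl | hx
    · exact absurd h (hf.top_notMem hv hlt ht)
    · have hwt : t ∈ R.Te w := ⟨(hf.mem_Vf_below_iff hv hlt ht h).1 hx, ht.2⟩
      exact ⟨t, hwt, (hf.Vf_child hw hv hlt hwt).symm ▸ h⟩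

theorem hval_child {w : V} (hw : w ≠ R.root) (hv : R.par w ≠ R.root) {X : Set V}
    (hX : ∀ x ∈ X, R.below w x) (h : V → ℕ) : R.hval w X h = R.hval (R.par w) X h := by
  have : R.cutE w X = R.cutE (R.par w) X := by
    ext x
    constructor
    · rintro ⟨hx, h⟩
      exact ⟨(below_par hw).trans hx, h⟩
    · rintro ⟨hx, h⟩
      refine ⟨?_, h⟩
      by_cases hxX : x ∈ X
      · exact hX x hxX
      · by_cases hpX : R.par x ∈ X
        · exact (hX _ hpX).trans (below_par (hx.ne_root hv))
        · exact absurd (iff_of_false hxX hpX) h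
  rw [hval, hval, this]

/-- A connected set containing `y` but not its parent lies below `y`. -/
theorem ConnSet.below_top {W : Set V} (hW : R.ConnSet W) {x y : V} (hy : y ∈ W)
    (hroot : y ≠ R.root) (hp : R.par y ∉ W) (hx : x ∈ W) : R.below y x := by
  by_contra h
  refine hp (hW y hy x hx _ ⟨Or.inl (below_par hroot), fun z hzy hzx => ?_⟩)
  rcases hzy.eq_or_par with rfl | hz
  · exact absurd hzx h
  · exact hz.2

theorem isComp_child_iff {w : V} (hw : w ≠ R.root) (hv : R.par w ≠ R.root) {U U' W : Set V}
    (hU : ∀ x ∈ R.Ve w, x ∈ U ↔ x ∈ U') (hW : ∀ x ∈ W, R.below w x) :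
    R.IsComp w (R.Ve w \ U) W ↔ R.IsComp (R.par w) (R.Ve (R.par w) \ U') W := by
  have hA : ∀ x ∈ R.Ve w, (x ∈ R.Ve w \ U ↔ x ∈ R.Ve (R.par w) \ U') := fun x hx =>
    ⟨fun h => ⟨Ve_subset_Ve_par hw hx, fun h' => h.2 ((hU x hx).2 h')⟩,
      fun h => ⟨hx, fun h' => h.2 ((hU x hx).1 h')⟩⟩
  constructor
  · rintro ⟨h1, h2, h3, h4, h5⟩
    refine ⟨h1, fun x hx => (hA x (Or.inr (hW x hx))).1 (h2 hx), h3, ?_, ?_⟩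
    · intro x _ hxW hp
      exact h4 x (hW x hxW) hxW ((hA _ (par_mem_Ve (hW x hxW))).2 hp)
    · intro x hx hpW hxA
      have hwx : R.below w x := (hW _ hpW).trans (below_par (hx.ne_root hv))
      exact h5 x hwx hpW ((hA x (Or.inr hwx)).2 hxA)
  · rintro ⟨h1, h2, h3, h4, h5⟩
    refine ⟨h1, fun x hx => (hA x (Or.inr (hW x hx))).2 (h2 hx), h3, ?_, ?_⟩
    · intro x hx hxW hp
      exact h4 x ((below_par hw).trans hx) hxW ((hA _ (par_mem_Ve hx)).1 hp)
    · intro x hx hpW hxA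
      exact h5 x ((below_par hw).trans hx) hpW ((hA x (Or.inr hx)).1 hxA)

theorem oddOf_child {w : V} (hw : w ≠ R.root) (hv : R.par w ≠ R.root) {U U' X : Set V}
    (hU : ∀ x ∈ R.Ve w, x ∈ U ↔ x ∈ U') (hX : ∀ x ∈ X, R.below w x) :
    R.oddOf w U X = R.oddOf (R.par w) U' X := by
  have key : ∀ W : Set V, R.ConnSet W → (∀ x ∈ W, x ∈ R.Ve (R.par w)) →
      (∃ y ∈ W, R.par y ∉ W ∧ R.par y ∈ X) → ∀ x ∈ W, R.below w x := by
    rintro W hW hWV ⟨y, hy, hpW, hpX⟩ x hx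
    have hyr : y ≠ R.root := by
      rintro rfl
      exact hpW (R.par_root.symm ▸ hy)
    exact (hX _ hpX).trans ((below_par hyr).trans (hW.below_top hy hyr hpW hx))
  ext W
  constructor
  · rintro ⟨h1, h2, h3⟩
    have hWw := key W h1.2.2.1 (fun x hx => Ve_subset_Ve_par hw (h1.2.1 hx).1) h3
    exact ⟨(isComp_child_iff hw hv hU hWw).1 h1, hval_child hw hv hWw R.c ▸ h2, h3⟩
  · rintro ⟨h1, h2, h3⟩
    have hWw := key W h1.2.2.1 (fun x hx => (h1.2.1 hx).1) h3
    exact ⟨(isComp_child_iff hw hv hU hWw).2 h1, (hval_child hw hv hWw R.c).symm ▸ h2, h3⟩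

theorem onPath_ne {w t t' : V} (h : R.onPath w t t') : t ≠ t' := by
  rintro rfl
  rcases h with h | h
  · exact h.2 h.1
  · exact h.1 h.2

theorem onPath_comm {w t t' : V} : R.onPath w t t' ↔ R.onPath w t' t := by
  unfold onPath
  tauto

theorem exists_onPath_iff {w t t' : V} :
    (∃ a b, s(t, t') = s(a, b) ∧ R.onPath w a b) ↔ R.onPath w t t' := by
  constructor
  · rintro ⟨a, b, h, hab⟩
    rcases Sym2.eq_iff.1 h with ⟨rfl, rfl⟩ | ⟨rfl, rfl⟩
    · exact hab
    · exact onPath_comm.1 hab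
  · exact fun h => ⟨t, t', rfl, h⟩

theorem IsDecomp.apply_eq_sum [Fintype V] {v w : V} {f : V → ℕ} {g : Sym2 V → ℕ}
    (hg : R.IsDecomp v f g) (hw : R.below v w) :
    f w = ∑ p : Sym2 V, if ∃ t t', p = s(t, t') ∧ R.onPath w t t' then g p else 0 := by
  rw [hg.2 w hw, finsum_mem_def, finsum_eq_sum_of_fintype]
  exact Finset.sum_congr rfl fun p _ => by simp [Set.indicator_apply]

theorem IsFlow.child [Fintype V] {w : V} {f : V → ℕ} (hw : w ≠ R.root)
    (hv : R.par w ≠ R.root) (hf : R.IsFlow (R.par w) f) : R.IsFlow w f := by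
  obtain ⟨g, hg⟩ := hf
  let φ : V → V := fun x => if R.below w x then x else R.par w
  refine ⟨fun q => if q.IsDiag then 0 else ∑ p : Sym2 V, if p.map φ = q then g p else 0,
    ?_, ?_⟩
  · intro q hq
    have hφ : ∀ t ∈ R.S (R.par w), φ t ∈ R.S w := by
      intro t ht
      by_cases h : R.below w t
      · rcases ht with rfl | ht
        · have h1 := h.dep_le
          have h2 := R.dep_par _ hw
          have h3 := R.dep_par _ hv
          omega
        · simp only [φ, if_pos h]
          exact Or.inr ⟨h, ht.2⟩
      · simp only [φ, if_neg h]
        exact Or.inl rfl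
    dsimp only at hq
    split_ifs at hq with hd
    · exact absurd rfl hq
    · obtain ⟨p, -, hp⟩ := Finset.exists_ne_zero_of_sum_ne_zero hq
      split_ifs at hp with hpq
      · obtain ⟨t, t', ht, ht', -, rfl⟩ := hg.1 p hp
        subst hpq
        exact ⟨φ t, φ t', hφ t ht, hφ t' ht', by simpa using hd, by simp⟩
      · exact absurd rfl hp
  · intro x hx
    have hφ : ∀ t, R.below x (φ t) ↔ R.below x t := by
      intro t
      by_cases h : R.below w t
      · simp only [φ, if_pos h]
      · simp only [φ, if_neg h]
        exact iff_of_false (fun h' => not_below_par hw (hx.trans h'))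
          fun h' => h (hx.trans h')
    have hmap : ∀ p : Sym2 V, (∃ t t', p.map φ = s(t, t') ∧ R.onPath x t t') ↔
        ∃ t t', p = s(t, t') ∧ R.onPath x t t' := by
      intro p
      induction p with | _ a b => ?_
      rw [Sym2.map_mk, exists_onPath_iff, exists_onPath_iff]
      simp only [onPath, hφ]
    rw [hg.apply_eq_sum ((below_par hw).trans hx), finsum_mem_def, finsum_eq_sum_of_fintype]
    have : ∀ q : Sym2 V, Set.indicator {p : Sym2 V | ∃ t t', p = s(t, t') ∧ R.onPath x t t'}
        (fun q => if q.IsDiag then 0 else ∑ p : Sym2 V, if p.map φ = q then g p else 0) q =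
        ∑ p : Sym2 V, if p.map φ = q then
          (if ∃ t t', p = s(t, t') ∧ R.onPath x t t' then g p else 0) else 0 := by
      intro q
      simp only [Set.indicator_apply, Set.mem_ofPred_eq]
      by_cases hq : ∃ t t', q = s(t, t') ∧ R.onPath x t t'
      · have hd : ¬ q.IsDiag := by
          obtain ⟨t, t', rfl, h⟩ := hq
          simpa using onPath_ne h
        rw [if_pos hq, if_neg hd]
        refine Finset.sum_congr rfl fun p _ => ?_
        split_ifs with h1 h2
        · rfl
        · exact absurd ((hmap p).1 (h1.symm ▸ hq)) h2
        · rfl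
      · rw [if_neg hq]
        refine (Finset.sum_eq_zero fun p _ => ?_).symm
        split_ifs with h1 h2
        · exact absurd (h1 ▸ (hmap p).2 h2) hq
        · rfl
        · rfl
    rw [Finset.sum_congr rfl fun q _ => this q, Finset.sum_comm]
    exact Finset.sum_congr rfl fun p _ => by simp

/-- A blocking flow of `I(e)` not saturating `e` restricts to a blocking flow of `I(e')` for
each child-edge `e'` of `e`. -/
theorem IsBlocking.child [Fintype V] {w : V} {f : V → ℕ} (hf : R.IsBlocking (R.par w) f)
    (hw : w ≠ R.root) (hv : R.par w ≠ R.root) (hlt : f (R.par w) < R.c (R.par w)) :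
    R.IsBlocking w f := by
  refine ⟨hf.1.child hw hv, fun x hx => hf.2.1 x ((below_par hw).trans hx), ?_, ?_, ?_⟩
  · intro t ht
    rw [hf.Vf_child hw hv hlt ht]
    exact hf.top_notMem hv hlt (Te_subset_Te_par hw ht)
  · intro t ht t' ht' hne
    rw [hf.Vf_child hw hv hlt ht, hf.Vf_child hw hv hlt ht']
    exact hf.2.2.2.1 t (Te_subset_Te_par hw ht) t' (Te_subset_Te_par hw ht') hne
  · intro t ht
    have hX : ∀ x ∈ R.Vf (R.par w) f t, R.below w x := fun x hx =>
      (hf.mem_Vf_below_iff hv hlt (Te_subset_Te_par hw ht) hx).2 ht.1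
    rw [hf.Vf_child hw hv hlt ht, hval_child hw hv hX, hval_child hw hv hX,
      oddOf_child hw hv (fun x hx => hf.mem_UT_child_iff hw hv hlt hx) hX]
    exact hf.2.2.2.2 t (Te_subset_Te_par hw ht)

theorem exists_child_below {v t : V} (h : R.below v t) (hne : v ≠ t) :
    ∃ w ∈ R.children v, R.below w t := by
  rcases Relation.ReflTransGen.cases_head h with h | ⟨w, hw, h⟩
  · exact absurd h hne
  · exact ⟨w, hw, h⟩

/-- At an internal vertex the flow values on the three incident edges are related as in `⊗`. -/
theorem IsFlow.exists_split [Fintype V] {v w₁ w₂ : V} (hv : v ≠ R.root) (hw : w₁ ≠ w₂)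
    (hch : R.children v = {w₁, w₂}) {f : V → ℕ} (hf : R.IsFlow v f) :
    ∃ i, i ≤ min (f w₁) (f w₂) ∧ f v = f w₁ + f w₂ - 2 * i := by
  obtain ⟨g, hg⟩ := hf
  have hw₁ : w₁ ∈ R.children v := by simp [hch]
  have hw₂ : w₂ ∈ R.children v := by simp [hch]
  have hvw₁ : R.below v w₁ := hw₁.1 ▸ below_par hw₁.2
  have hvw₂ : R.below v w₂ := hw₂.1 ▸ below_par hw₂.2
  have hdisj : ∀ t, R.below w₁ t → ¬ R.below w₂ t := by
    intro t h1 h2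
    have d1 := R.dep_par _ hw₁.2
    have d2 := R.dep_par _ hw₂.2
    rw [hw₁.1] at d1
    rw [hw₂.1] at d2
    rcases h1.total h2 with h | h
    · rcases h.eq_or_par with h | ⟨-, h⟩
      · exact hw h
      · have := h.dep_le
        rw [hw₂.1] at this
        omega
    · rcases h.eq_or_par with h | ⟨-, h⟩
      · exact hw h.symm
      · have := h.dep_le
        rw [hw₁.1] at this
        omega
  have hS : ∀ t ∈ R.S v, (R.below v t ↔ R.below w₁ t ∨ R.below w₂ t) := by
    intro t ht
    refine ⟨fun h => ?_, fun h => h.elim hvw₁.trans hvw₂.trans⟩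
    rcases ht with rfl | ht
    · exact absurd h (not_below_par hv)
    · have hne : v ≠ t := by
        rintro rfl
        exact ht.2.2 w₁ hw₁.2 hw₁.1
      obtain ⟨w, hw, hwt⟩ := exists_child_below h hne
      rw [hch] at hw
      rcases hw with rfl | rfl
      · exact Or.inl hwt
      · exact Or.inr hwt
  have e₁ := hg.apply_eq_sum hvw₁
  have e₂ := hg.apply_eq_sum hvw₂
  have e := hg.apply_eq_sum (below_refl v)
  let i : ℕ := ∑ p : Sym2 V, if (∃ t t', p = s(t, t') ∧ R.onPath w₁ t t') ∧
    (∃ t t', p = s(t, t') ∧ R.onPath w₂ t t') then g p else 0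
  have hi₁ : i ≤ f w₁ := by
    rw [e₁]
    refine Finset.sum_le_sum fun p _ => ?_
    split_ifs <;> simp_all
  have hi₂ : i ≤ f w₂ := by
    rw [e₂]
    refine Finset.sum_le_sum fun p _ => ?_
    split_ifs <;> simp_all
  have hsum : f w₁ + f w₂ = f v + 2 * i := by
    rw [e₁, e₂, e, Finset.mul_sum, ← Finset.sum_add_distrib, ← Finset.sum_add_distrib]
    refine Finset.sum_congr rfl fun p _ => ?_
    by_cases hp : g p = 0
    · simp [hp]
    · obtain ⟨t, t', ht, ht', -, rfl⟩ := hg.1 p hp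
      simp only [exists_onPath_iff]
      simp only [onPath, hS t ht, hS t' ht']
      have d1 := hdisj t
      have d2 := hdisj t'
      by_cases a1 : R.below w₁ t <;> by_cases a2 : R.below w₂ t <;>
        by_cases b1 : R.below w₁ t' <;> by_cases b2 : R.below w₂ t' <;>
        simp [a1, a2, b1, b2] at d1 d2 ⊢ <;> omega
  exact ⟨i, le_min hi₁ hi₂, by omega⟩

end RTI

/-- Main Lemma (iv): with the induction hypotheses of the Main Lemma,
if `I(e)` admits a blocking flow `f` with `f(e) < c(e)`, then `f(e) ∈ ⟨ã,b̃⟩`. -/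
theorem RTI.mainLemma_iv {V : Type*} [Fintype V] [DecidableEq V]
    (R : RTI V) (v : V) (hv : v ≠ R.root)
    (w₁ w₂ : V) (hw : w₁ ≠ w₂) (hch : R.children v = {w₁, w₂})
    (hind : ∀ x, x ≠ R.root → R.dep v < R.dep x → R.CondA x ∧ R.CondB x)
    (ta tb : ℕ) (hab : otimes (R.Psi w₁) (R.Psi w₂) = Iv ta tb)
    (f : V → ℕ) (hf : R.IsBlocking v f) (hlt : f v < R.c v) :
    f v ∈ Iv ta tb := by
  have hw₁ : w₁ ∈ R.children v := by simp [hch]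
  have hw₂ : w₂ ∈ R.children v := by simp [hch]
  have key : ∀ w ∈ R.children v, f w ∈ R.Psi w := by
    rintro w ⟨rfl, hwr⟩
    exact ⟨f, hf.child hwr hv hlt, rfl⟩
  rw [← hab]
  exact ⟨f w₁, key _ hw₁, f w₂, key _ hw₂, hf.1.exists_split hv hw hch⟩
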